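/- Let A = (A_1,…,A_{N_1}) be an N_1-valued observable in ℂ^{h_1} and B = (B_1,…,B_{N_2}) an N_2-valued observable in ℂ^{h_2}. Define the disjoint sum A ⊙ B as the (N_1+N_2)-valued observable in ℂ^{h_1} ⊕ ℂ^{h_2} whose components are the block-diagonal matrices A_j ⊕ 0 for j = 1,…,N_1 and 0 ⊕ B_j for j = 1,…,N_2. If A and B are both extremal, then A ⊙ B is extremal. -/

import Mathlib

open Matrix
open scoped ComplexOrder

/-- An `ι`-valued observable in `ℂ^n`: a family of positive semidefinite matrices
summing to the identity. -/
def IsObservable {ι n : Type*} [Fintype ι] [Fintype n] [DecidableEq n]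
    (A : ι → Matrix n n ℂ) : Prop :=
  (∀ i, (A i).PosSemidef) ∧ ∑ i, A i = 1

/-- An observable is extremal if it is an extreme point of the convex set of observables. -/
def IsExtremalObservable {ι n : Type*} [Fintype ι] [Fintype n] [DecidableEq n]
    (A : ι → Matrix n n ℂ) : Prop :=
  A ∈ Set.extremePoints ℝ {B : ι → Matrix n n ℂ | IsObservable B}

namespace Matrix.PosSemidef

variable {m n : Type*} [Fintype m] [Fintype n]

/-- A block-diagonal matrix with positive semidefinite blocks is positive semidefinite. -/
theorem fromBlocks_diagonal {A : Matrix m m ℂ} {D : Matrix n n ℂ}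
    (hA : A.PosSemidef) (hD : D.PosSemidef) : (fromBlocks A 0 0 D).PosSemidef := by
  refine .of_dotProduct_mulVec_nonneg ?_ fun x => ?_
  · exact hA.isHermitian.fromBlocks (by simp) hD.isHermitian
  · have h := add_nonneg (hA.dotProduct_mulVec_nonneg (x ∘ Sum.inl))
      (hD.dotProduct_mulVec_nonneg (x ∘ Sum.inr))
    rw [fromBlocks_mulVec]
    simpa [dotProduct, Fintype.sum_sum_type] using h

/-- A zero diagonal entry of a positive semidefinite matrix annihilates its column. -/
theorem apply_eq_zero_of_diag_right {A : Matrix n n ℂ} (hA : A.PosSemidef)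
    {i : n} (hi : A i i = 0) (j : n) : A j i = 0 := by
  classical
  have h := (hA.dotProduct_mulVec_zero_iff (Pi.single i 1)).1 (by simp [hi])
  simpa using congrFun h j

/-- A zero diagonal entry of a positive semidefinite matrix annihilates its row. -/
theorem apply_eq_zero_of_diag_left {A : Matrix n n ℂ} (hA : A.PosSemidef)
    {i : n} (hi : A i i = 0) (j : n) : A i j = 0 := by
  rw [← hA.isHermitian.apply, hA.apply_eq_zero_of_diag_right hi, star_zero]

end Matrix.PosSemidef

section Observable

variable {ι κ n m : Type*} [Fintype ι] [Fintype κ] [Fintype n] [Fintype m]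
  [DecidableEq n] [DecidableEq m]

/-- Compressing an observable to the coordinates `e`, and keeping only the outcomes `f` outside of
which the compression vanishes, yields an observable. -/
theorem IsObservable.compress {Z : κ → Matrix m m ℂ} (hZ : IsObservable Z)
    {f : ι → κ} (hf : f.Injective) {e : n → m} (he : e.Injective)
    (h0 : ∀ k ∉ Set.range f, (Z k).submatrix e e = 0) :
    IsObservable fun i => (Z (f i)).submatrix e e := by
  refine ⟨fun i => (hZ.1 _).submatrix e, ?_⟩
  rw [Fintype.sum_of_injective f hf (fun i => (Z (f i)).submatrix e e)
    (fun k => (Z k).submatrix e e) h0 fun _ => rfl, ← submatrix_one e he, ← hZ.2]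
  ext a b
  simp [Matrix.sum_apply]

/-- The disjoint sum of two observables is an observable. -/
theorem IsObservable.disjointSum {A : ι → Matrix n n ℂ} {B : κ → Matrix m m ℂ}
    (hA : IsObservable A) (hB : IsObservable B) :
    IsObservable (Sum.elim (fun j => fromBlocks (A j) 0 0 0) fun j => fromBlocks 0 0 0 (B j)) := by
  refine ⟨?_, ?_⟩
  · rintro (j | j)
    · exact (hA.1 j).fromBlocks_diagonal .zero
    · exact Matrix.PosSemidef.zero.fromBlocks_diagonal (hB.1 j)
  · rw [Fintype.sum_sum_type, ← fromBlocks_one, ← hA.2, ← hB.2]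
    ext (a | a) (b | b) <;> simp [Matrix.sum_apply]

/-- If `C` lies in an open segment of observables with endpoint `X`, then every vanishing diagonal
entry of a component of `C` also vanishes for `X`. -/
theorem IsObservable.diag_eq_zero_of_mem_openSegment {C X Y : κ → Matrix m m ℂ}
    (hX : IsObservable X) (hY : IsObservable Y) (hC : C ∈ openSegment ℝ X Y)
    {k : κ} {i : m} (h : C k i i = 0) : X k i i = 0 := by
  obtain ⟨a, b, ha, hb, -, rfl⟩ := hC
  have hx : 0 ≤ a • X k i i := smul_nonneg ha.le (hX.1 k).diag_nonneg
  have hy : 0 ≤ b • Y k i i := smul_nonneg hb.le (hY.1 k).diag_nonneg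
  have h' : a • X k i i + b • Y k i i = 0 := h
  exact (smul_eq_zero.1 ((add_eq_zero_iff_of_nonneg hx hy).1 h').1).resolve_left ha.ne.symm

/-- If the compression of `C` to the coordinates `e` is an extremal observable supported on the
outcomes `f`, then an observable that is the endpoint of an open segment of observables
through `C` has the same compression. -/
theorem IsExtremalObservable.compress_eq_of_mem_openSegment {A : ι → Matrix n n ℂ}
    (hA : IsExtremalObservable A) {C X Y : κ → Matrix m m ℂ} (hX : IsObservable X)
    (hY : IsObservable Y) (hC : C ∈ openSegment ℝ X Y) {f : ι → κ} (hf : f.Injective)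
    {e : n → m} (he : e.Injective) (hCA : ∀ i, (C (f i)).submatrix e e = A i)
    (h0 : ∀ k ∉ Set.range f, (C k).submatrix e e = 0) (i : ι) :
    (X (f i)).submatrix e e = A i := by
  have vanish {X Y : κ → Matrix m m ℂ} (hX : IsObservable X) (hY : IsObservable Y)
      (hC : C ∈ openSegment ℝ X Y) (k) (hk : k ∉ Set.range f) : (X k).submatrix e e = 0 := by
    ext a b
    exact (hX.1 k).apply_eq_zero_of_diag_left (hX.diag_eq_zero_of_mem_openSegment hY hC
      (congrFun₂ (h0 k hk) a a)) _
  refine congrFun (hA.2 (hX.compress hf he (vanish hX hY hC))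
    (hY.compress hf he (vanish hY hX (openSegment_symm ℝ X Y ▸ hC))) ?_) i
  obtain ⟨a, b, ha, hb, hab, rfl⟩ := hC
  exact ⟨a, b, ha, hb, hab, funext hCA⟩

end Observable

/-- The disjoint sum of two extremal observables is extremal. -/
theorem stmt_16 {N₁ N₂ h₁ h₂ : ℕ}
    (A : Fin N₁ → Matrix (Fin h₁) (Fin h₁) ℂ)
    (B : Fin N₂ → Matrix (Fin h₂) (Fin h₂) ℂ)
    (hA : IsObservable A) (hB : IsObservable B)
    (hAex : IsExtremalObservable A) (hBex : IsExtremalObservable B) :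
    IsExtremalObservable
      (Sum.elim (fun j => Matrix.fromBlocks (A j) 0 0 0)
                (fun j => Matrix.fromBlocks 0 0 0 (B j)) :
        Fin N₁ ⊕ Fin N₂ → Matrix (Fin h₁ ⊕ Fin h₂) (Fin h₁ ⊕ Fin h₂) ℂ) := by
  refine ⟨hA.disjointSum hB, fun X hX Y hY hC => ?_⟩
  have diag {k i} := hX.diag_eq_zero_of_mem_openSegment hY hC (k := k) (i := i)
  have blockA := hAex.compress_eq_of_mem_openSegment hX hY hC Sum.inl_injective Sum.inl_injective
    (fun _ => rfl) (by rintro (j | j) hj; exacts [absurd ⟨j, rfl⟩ hj, rfl])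
  have blockB := hBex.compress_eq_of_mem_openSegment hX hY hC Sum.inr_injective Sum.inr_injective
    (fun _ => rfl) (by rintro (j | j) hj; exacts [rfl, absurd ⟨j, rfl⟩ hj])
  ext (j | j) (a | a) (b | b)
  · exact congrFun₂ (blockA j) a b
  · exact (hX.1 _).apply_eq_zero_of_diag_right (diag rfl) _
  · exact (hX.1 _).apply_eq_zero_of_diag_left (diag rfl) _
  · exact (hX.1 _).apply_eq_zero_of_diag_left (diag rfl) _
  · exact (hX.1 _).apply_eq_zero_of_diag_left (diag rfl) _
  · exact (hX.1 _).apply_eq_zero_of_diag_left (diag rfl) _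
  · exact (hX.1 _).apply_eq_zero_of_diag_right (diag rfl) _
  · exact congrFun₂ (blockB j) a b
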